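/- Let A be a set of 5 positive integers. Then |4^∧_± A| ≥ 25, with equality if and only if A = min(A)·{1, 3, 5, 7, 9}. -/

import Mathlib

open Finset

/-- The restricted `h`-fold signed sumset of a finite set `A` of integers:
all sums `∑ λᵢ aᵢ` with `λᵢ ∈ {-1,0,1}` and `∑ |λᵢ| = h`. -/
def signedSumset (h : ℕ) (A : Finset ℤ) : Set ℤ :=
  {s | ∃ f : ℤ → ℤ, (∀ a, f a = -1 ∨ f a = 0 ∨ f a = 1) ∧ (∀ a ∉ A, f a = 0) ∧
    (∑ a ∈ A, |f a|) = (h : ℤ) ∧ s = ∑ a ∈ A, f a * a}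

/-- A vector with entries in `{-1, 0, 1}`, exactly `h` of which are nonzero. -/
def IsSigning {n : ℕ} (h : ℕ) (f : Fin n → ℤ) : Prop :=
  (∀ i, f i = -1 ∨ f i = 0 ∨ f i = 1) ∧ ∑ i, |f i| = (h : ℤ)

instance {n h : ℕ} (f : Fin n → ℤ) : Decidable (IsSigning h f) :=
  inferInstanceAs (Decidable (_ ∧ _))

/-- The sum of the entries of `x` with coefficients `f`. -/
def signedSum {n : ℕ} (x f : Fin n → ℤ) : ℤ := ∑ i, f i * x i

lemma IsSigning.neg {n h : ℕ} {f : Fin n → ℤ} (hf : IsSigning h f) : IsSigning h (-f) := by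
  refine ⟨fun i => ?_, by simpa using hf.2⟩
  have := hf.1 i
  simp only [Pi.neg_apply]
  omega

lemma signedSum_neg {n : ℕ} (x f : Fin n → ℤ) : signedSum x (-f) = -signedSum x f := by
  simp [signedSum]

lemma mem_signedSumset_image {n h : ℕ} {x : Fin n → ℤ} (hx : Function.Injective x) {s : ℤ} :
    s ∈ signedSumset h (univ.image x) ↔ ∃ f, IsSigning h f ∧ signedSum x f = s := by
  simp only [signedSumset, Set.mem_ofPred_eq, sum_image hx.injOn]
  constructor
  · rintro ⟨f, hf, -, hsum, rfl⟩
    exact ⟨f ∘ x, ⟨fun i => hf _, hsum⟩, rfl⟩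
  · rintro ⟨f, hf, rfl⟩
    refine ⟨Function.extend x f 0, fun a => ?_, fun a ha => ?_, ?_, ?_⟩
    · by_cases ha : ∃ i, x i = a
      · obtain ⟨i, rfl⟩ := ha
        simpa [hx.extend_apply] using hf.1 i
      · simp [Function.extend_apply' _ _ _ ha]
    · exact Function.extend_apply' _ _ _ (by simpa using ha)
    · simpa [hx.extend_apply] using hf.2
    · simp [hx.extend_apply, signedSum]

lemma signedSumset_finite (h : ℕ) (A : Finset ℤ) : (signedSumset h A).Finite := by
  refine (Set.finite_Icc (-∑ a ∈ A, |a|) (∑ a ∈ A, |a|)).subset ?_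
  rintro s ⟨f, hf, -, -, rfl⟩
  rw [Set.mem_Icc, ← abs_le]
  refine (abs_sum_le_sum_abs _ _).trans (sum_le_sum fun a _ => ?_)
  rcases hf a with h | h | h <;> simp [h]

lemma length_le_ncard_signedSumset {n h : ℕ} {x : Fin n → ℤ} (hx : Function.Injective x)
    (l : List (Fin n → ℤ)) (hl : ∀ f ∈ l, IsSigning h f)
    (hnd : (l.map (signedSum x)).Nodup) :
    l.length ≤ (signedSumset h (univ.image x)).ncard := by
  rw [← List.length_map (signedSum x), ← List.toFinset_card_of_nodup hnd,
    ← Set.ncard_coe_finset]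
  refine Set.ncard_le_ncard (fun s hs => ?_) (signedSumset_finite _ _)
  obtain ⟨f, hf, rfl⟩ : ∃ f ∈ l, signedSum x f = s := by simpa using hs
  exact (mem_signedSumset_image hx).2 ⟨f, hl f hf, rfl⟩

lemma two_mul_length_le_ncard_signedSumset {n h : ℕ} {x : Fin n → ℤ}
    (hx : Function.Injective x) (l : List (Fin n → ℤ)) (hl : ∀ f ∈ l, IsSigning h f)
    (hc : (0 :: l.map (signedSum x)).IsChain (· < ·)) :
    2 * l.length ≤ (signedSumset h (univ.image x)).ncard := by
  rw [List.isChain_iff_pairwise, List.pairwise_cons] at hc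
  obtain ⟨hpos, hlt⟩ := hc
  simp only [List.forall_mem_map] at hpos
  have hnd := hlt.imp ne_of_lt
  have key := length_le_ncard_signedSumset hx (l ++ l.map (-·)) (h := h)
    (by
      simp only [List.mem_append, List.mem_map]
      rintro f (hf | ⟨f, hf, rfl⟩)
      exacts [hl f hf, (hl f hf).neg])
    (by
      simp only [List.map_append, List.map_map, List.nodup_append]
      refine ⟨hnd, ?_, ?_⟩
      · have : signedSum x ∘ (-·) = Neg.neg ∘ signedSum x := funext (signedSum_neg x)
        rw [this, ← List.map_map]
        exact List.Nodup.map neg_injective hnd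
      · simp only [List.forall_mem_map, Function.comp_apply, signedSum_neg]
        intro f hf g hg
        have := hpos f hf
        have := hpos g hg
        omega)
  simpa [two_mul] using key

lemma le_ncard_or_eq_odd_multiples {a b c d e : ℤ} (ha : 0 < a) (hab : a < b) (hbc : b < c)
    (hcd : c < d) (hde : d < e) :
    26 ≤ (signedSumset 4 (univ.image ![a, b, c, d, e])).ncard ∨
      b = 3 * a ∧ c = 5 * a ∧ d = 7 * a ∧ e = 9 * a := by
  have hx : Function.Injective ![a, b, c, d, e] := by
    refine (Fin.strictMono_iff_lt_succ.2 fun i => ?_).injective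
    fin_cases i <;> simpa
  have of_chain (l : List (Fin 5 → ℤ)) (hl : l.length = 13 ∧ ∀ f ∈ l, IsSigning 4 f)
      (hc : (0 :: l.map (signedSum ![a, b, c, d, e])).IsChain (· < ·)) :
      26 ≤ (signedSumset 4 (univ.image ![a, b, c, d, e])).ncard ∨
        b = 3 * a ∧ c = 5 * a ∧ d = 7 * a ∧ e = 9 * a :=
    .inl <| by simpa [hl.1] using two_mul_length_le_ncard_signedSumset hx l hl.2 hc
  rcases lt_trichotomy (a + 2 * b) e with h1 | h1 | h1
  · rcases lt_trichotomy (2 * c) (a + d) with h2 | h2 | h2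
    · rcases lt_or_ge (2 * a + d) e with h3 | h3
      · refine of_chain
            [![1, -1, -1, 1, 0], ![-1, 1, -1, 1, 0], ![1, 1, -1, 1, 0], ![1, -1, 1, 1, 0],
             ![-1, -1, 1, 0, 1], ![0, -1, -1, 1, 1], ![-1, 0, -1, 1, 1], ![1, 0, -1, 1, 1],
             ![1, -1, 0, 1, 1], ![-1, 1, 0, 1, 1], ![1, 1, 0, 1, 1], ![1, 0, 1, 1, 1],
             ![0, 1, 1, 1, 1]] (by decide) ?_
        simp [signedSum, Fin.sum_univ_five]; omega
      · refine of_chain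
            [![1, 1, 0, 1, -1], ![1, 0, 1, 1, -1], ![0, 1, 1, 1, -1], ![-1, -1, 1, 1, 0],
             ![-1, -1, 1, 0, 1], ![0, -1, -1, 1, 1], ![-1, 0, -1, 1, 1], ![1, 0, -1, 1, 1],
             ![1, -1, 0, 1, 1], ![-1, 1, 0, 1, 1], ![1, 1, 0, 1, 1], ![1, 0, 1, 1, 1],
             ![0, 1, 1, 1, 1]] (by decide) ?_
        simp [signedSum, Fin.sum_univ_five]; omega
    · rcases lt_or_ge (a + 2 * b) d with h3 | h3
      · refine of_chain
            [![1, -1, -1, 0, 1], ![-1, 0, 1, -1, 1], ![1, 0, 1, -1, 1], ![1, 1, -1, 0, 1],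
             ![0, -1, -1, 1, 1], ![1, -1, 1, 0, 1], ![1, 0, -1, 1, 1], ![0, 1, -1, 1, 1],
             ![1, 1, 1, 0, 1], ![0, -1, 1, 1, 1], ![-1, 0, 1, 1, 1], ![1, 0, 1, 1, 1],
             ![0, 1, 1, 1, 1]] (by decide) ?_
        simp [signedSum, Fin.sum_univ_five]; omega
      · refine of_chain
            [![1, -1, -1, 0, 1], ![-1, 0, 1, -1, 1], ![1, 1, 0, -1, 1], ![1, 0, 1, -1, 1],
             ![1, 1, -1, 0, 1], ![1, -1, 1, 0, 1], ![1, 0, -1, 1, 1], ![1, -1, 0, 1, 1],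
             ![0, -1, 1, 1, 1], ![-1, 0, 1, 1, 1], ![1, 1, 0, 1, 1], ![1, 0, 1, 1, 1],
             ![0, 1, 1, 1, 1]] (by decide) ?_
        simp [signedSum, Fin.sum_univ_five]; omega
    · rcases lt_trichotomy (a + b + c) e with h3 | h3 | h3
      · rcases le_or_gt (2 * a + c) d with h4 | h4
        · refine of_chain
              [![-1, -1, -1, 0, 1], ![1, -1, -1, 0, 1], ![0, -1, 1, -1, 1], ![-1, 0, 1, -1, 1],
               ![1, 0, 1, -1, 1], ![-1, 0, -1, 1, 1], ![1, 0, -1, 1, 1], ![0, 1, -1, 1, 1],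
               ![-1, 1, 1, 0, 1], ![-1, 1, 0, 1, 1], ![1, 1, 0, 1, 1], ![1, 0, 1, 1, 1],
               ![0, 1, 1, 1, 1]] (by decide) ?_
          simp [signedSum, Fin.sum_univ_five]; omega
        · refine of_chain
              [![1, -1, 0, -1, 1], ![1, -1, -1, 0, 1], ![0, -1, 1, -1, 1], ![0, -1, -1, 1, 1],
               ![-1, 0, -1, 1, 1], ![1, 0, -1, 1, 1], ![0, 1, -1, 1, 1], ![-1, 1, 1, 0, 1],
               ![-1, 1, 0, 1, 1], ![1, 1, 1, 0, 1], ![1, 1, 0, 1, 1], ![1, 0, 1, 1, 1],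
               ![0, 1, 1, 1, 1]] (by decide) ?_
          simp [signedSum, Fin.sum_univ_five]; omega
      · rcases lt_trichotomy (2 * a + d) e with h4 | h4 | h4
        · refine of_chain
              [![1, 1, 1, -1, 0], ![1, 1, -1, 1, 0], ![0, -1, -1, 1, 1], ![1, -1, 1, 1, 0],
               ![-1, -1, 1, 0, 1], ![1, -1, 1, 0, 1], ![1, -1, 0, 1, 1], ![1, 1, 1, 1, 0],
               ![-1, 1, 1, 0, 1], ![1, 1, 1, 0, 1], ![1, 1, 0, 1, 1], ![1, 0, 1, 1, 1],
               ![0, 1, 1, 1, 1]] (by decide) ?_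
          simp [signedSum, Fin.sum_univ_five]; omega
        · rcases lt_trichotomy (a + 2 * b) d with h5 | h5 | h5
          · refine of_chain
                [![1, 1, 0, -1, 1], ![-1, 0, 1, -1, 1], ![1, 0, 1, -1, 1], ![0, 1, 1, -1, 1],
                 ![1, -1, 1, 1, 0], ![1, -1, 1, 0, 1], ![1, -1, 0, 1, 1], ![1, 1, 1, 1, 0],
                 ![1, 1, 1, 0, 1], ![1, 1, 0, 1, 1], ![-1, 0, 1, 1, 1], ![1, 0, 1, 1, 1],
                 ![0, 1, 1, 1, 1]] (by decide) ?_
            simp [signedSum, Fin.sum_univ_five]; omega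
          · rcases lt_trichotomy (2 * a + c) d with h6 | h6 | h6
            · refine of_chain
                  [![1, 0, 1, -1, 1], ![1, 1, -1, 0, 1], ![1, -1, 1, 1, 0], ![1, -1, 1, 0, 1],
                   ![1, 0, -1, 1, 1], ![1, -1, 0, 1, 1], ![0, 1, -1, 1, 1], ![1, 1, 1, 1, 0],
                   ![1, 1, 1, 0, 1], ![-1, 1, 0, 1, 1], ![1, 1, 0, 1, 1], ![1, 0, 1, 1, 1],
                   ![0, 1, 1, 1, 1]] (by decide) ?_
              simp [signedSum, Fin.sum_univ_five]; omega
            · exact Or.inr (by omega)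
            · refine of_chain
                  [![1, 1, 0, -1, 1], ![1, 1, -1, 0, 1], ![1, 0, 1, -1, 1], ![1, -1, 1, 1, 0],
                   ![1, 0, -1, 1, 1], ![1, -1, 1, 0, 1], ![1, -1, 0, 1, 1], ![1, 1, 1, 1, 0],
                   ![-1, 1, 0, 1, 1], ![1, 1, 1, 0, 1], ![1, 1, 0, 1, 1], ![1, 0, 1, 1, 1],
                   ![0, 1, 1, 1, 1]] (by decide) ?_
              simp [signedSum, Fin.sum_univ_five]; omega
          · refine of_chain
                [![0, -1, 1, -1, 1], ![-1, 0, 1, -1, 1], ![1, 1, 0, -1, 1], ![1, 0, 1, -1, 1],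
                 ![0, 1, 1, -1, 1], ![1, -1, 1, 0, 1], ![1, -1, 0, 1, 1], ![1, 1, 1, 1, 0],
                 ![0, -1, 1, 1, 1], ![1, 1, 1, 0, 1], ![1, 1, 0, 1, 1], ![1, 0, 1, 1, 1],
                 ![0, 1, 1, 1, 1]] (by decide) ?_
            simp [signedSum, Fin.sum_univ_five]; omega
        · refine of_chain
              [![-1, 1, -1, 0, 1], ![1, 1, -1, 1, 0], ![0, -1, -1, 1, 1], ![-1, -1, 1, 0, 1],
               ![1, -1, 1, 1, 0], ![-1, -1, 0, 1, 1], ![-1, 1, 1, 1, 0], ![-1, 1, 1, 0, 1],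
               ![1, 1, 1, 1, 0], ![1, 1, 1, 0, 1], ![1, 1, 0, 1, 1], ![1, 0, 1, 1, 1],
               ![0, 1, 1, 1, 1]] (by decide) ?_
          simp [signedSum, Fin.sum_univ_five]; omega
      · refine of_chain
            [![1, 1, 1, 0, -1], ![1, 1, 0, 1, -1], ![1, 0, 1, 1, -1], ![0, 1, 1, 1, -1],
             ![-1, -1, 1, 1, 0], ![1, -1, 1, 1, 0], ![1, -1, 1, 0, 1], ![1, -1, 0, 1, 1],
             ![1, 1, 1, 1, 0], ![1, 1, 1, 0, 1], ![1, 1, 0, 1, 1], ![1, 0, 1, 1, 1],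
             ![0, 1, 1, 1, 1]] (by decide) ?_
        simp [signedSum, Fin.sum_univ_five]; omega
  · rcases le_or_gt (2 * a + d) e with h2 | h2
    · refine of_chain
          [![-1, 1, 1, -1, 0], ![1, 1, 1, -1, 0], ![-1, 1, 0, -1, 1], ![1, 1, 0, -1, 1],
           ![1, 1, -1, 0, 1], ![1, 0, -1, 1, 1], ![1, -1, 0, 1, 1], ![0, 1, -1, 1, 1],
           ![-1, 1, 1, 0, 1], ![1, 1, 1, 0, 1], ![1, 1, 0, 1, 1], ![1, 0, 1, 1, 1],
           ![0, 1, 1, 1, 1]] (by decide) ?_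
      simp [signedSum, Fin.sum_univ_five]; omega
    · refine of_chain
          [![1, 1, 1, 0, -1], ![1, 1, 0, 1, -1], ![1, 0, 1, 1, -1], ![0, 1, 1, 1, -1],
           ![-1, -1, 1, 0, 1], ![1, -1, 1, 1, 0], ![-1, 1, 1, 1, 0], ![-1, 1, 1, 0, 1],
           ![1, 1, 1, 1, 0], ![1, 1, 1, 0, 1], ![1, 1, 0, 1, 1], ![1, 0, 1, 1, 1],
           ![0, 1, 1, 1, 1]] (by decide) ?_
      simp [signedSum, Fin.sum_univ_five]; omega
  · rcases le_or_gt (2 * a + c) e with h2 | h2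
    · refine of_chain
          [![1, 1, 0, 1, -1], ![1, 0, 1, 1, -1], ![-1, -1, 1, 1, 0], ![1, -1, 1, 1, 0],
           ![1, -1, 1, 0, 1], ![1, -1, 0, 1, 1], ![0, 1, -1, 1, 1], ![0, -1, 1, 1, 1],
           ![1, 1, 1, 1, 0], ![1, 1, 1, 0, 1], ![1, 1, 0, 1, 1], ![1, 0, 1, 1, 1],
           ![0, 1, 1, 1, 1]] (by decide) ?_
      simp [signedSum, Fin.sum_univ_five]; omega
    · refine of_chain
          [![-1, 1, -1, 1, 0], ![-1, -1, 1, 1, 0], ![-1, -1, 1, 0, 1], ![-1, -1, 0, 1, 1],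
           ![1, -1, 1, 1, 0], ![1, -1, 1, 0, 1], ![1, -1, 0, 1, 1], ![0, -1, 1, 1, 1],
           ![1, 1, 1, 1, 0], ![1, 1, 1, 0, 1], ![1, 1, 0, 1, 1], ![1, 0, 1, 1, 1],
           ![0, 1, 1, 1, 1]] (by decide) ?_
      simp [signedSum, Fin.sum_univ_five]; omega

lemma ncard_signedSumset_odd_multiples {m : ℤ} (hm : 0 < m) :
    (signedSumset 4 (univ.image ![m, 3 * m, 5 * m, 7 * m, 9 * m])).ncard = 25 := by
  have hx : Function.Injective ![m, 3 * m, 5 * m, 7 * m, 9 * m] := by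
    refine (Fin.strictMono_iff_lt_succ.2 fun i => ?_).injective
    fin_cases i <;> simp <;> omega
  apply le_antisymm
  · have hsub : signedSumset 4 (univ.image ![m, 3 * m, 5 * m, 7 * m, 9 * m]) ⊆
        ((Icc (-12 : ℤ) 12).image (2 * m * ·) : Finset ℤ) := by
      intro s hs
      obtain ⟨f, ⟨hf, hsum⟩, rfl⟩ := (mem_signedSumset_image hx).1 hs
      have habs (i) : ∃ k, f i = |f i| - 2 * k ∧ 0 ≤ k ∧ k ≤ |f i| ∧ |f i| ≤ 1 := by
        rcases hf i with h | h | h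
        exacts [⟨1, by simp [h]⟩, ⟨0, by simp [h]⟩, ⟨0, by simp [h]⟩]
      choose k hk using habs
      rw [Fin.sum_univ_five] at hsum
      have h0 := hk 0
      have h1 := hk 1
      have h2 := hk 2
      have h3 := hk 3
      have h4 := hk 4
      obtain ⟨t, ht⟩ : ∃ t, f 0 + 3 * f 1 + 5 * f 2 + 7 * f 3 + 9 * f 4 = 2 * t :=
        ⟨_, (Int.mul_ediv_cancel' (by omega)).symm⟩
      simp only [coe_image, coe_Icc, Set.mem_image, Set.mem_Icc]
      refine ⟨t, by omega, ?_⟩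
      simp [signedSum, Fin.sum_univ_five]
      linear_combination -m * ht
    refine (Set.ncard_le_ncard hsub (finite_toSet _)).trans ?_
    rw [Set.ncard_coe_finset]
    exact card_image_le
  · let p : List (Fin 5 → ℤ) :=
      [![1, 1, 1, -1, 0], ![1, 0, 1, 1, -1], ![1, 1, 0, -1, 1], ![1, 1, -1, 0, 1],
        ![1, -1, 1, 1, 0], ![1, 0, -1, 1, 1], ![1, -1, 0, 1, 1], ![1, 1, 1, 1, 0],
        ![1, 1, 1, 0, 1], ![1, 1, 0, 1, 1], ![1, 0, 1, 1, 1], ![0, 1, 1, 1, 1]]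
    have hmul : signedSum ![m, 3 * m, 5 * m, 7 * m, 9 * m] =
        (m * ·) ∘ signedSum ![1, 3, 5, 7, 9] := by
      ext f
      simp [signedSum, Fin.sum_univ_five]
      ring
    refine length_le_ncard_signedSumset hx (![1, 1, 1, 0, -1] :: (p ++ p.map (-·)))
      (by decide) ?_
    rw [hmul, ← List.map_map]
    exact List.Nodup.map (mul_right_injective₀ hm.ne') (by decide)

theorem stmt16 (A : Finset ℤ) (hcard : A.card = 5) (hpos : ∀ a ∈ A, 0 < a)
    (hne : A.Nonempty) :
    25 ≤ (signedSumset 4 A).ncard ∧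
    ((signedSumset 4 A).ncard = 25 ↔
      A = ({1, 3, 5, 7, 9} : Finset ℤ).image (fun x => A.min' hne * x)) := by
  have hmono := (A.orderEmbOfFin hcard).strictMono
  have hA : univ.image (A.orderEmbOfFin hcard) = A := image_orderEmbOfFin_univ A hcard
  have hmin : A.min' hne = A.orderEmbOfFin hcard 0 := (orderEmbOfFin_zero hcard (by norm_num)).symm
  have h0 := hpos _ (A.orderEmbOfFin_mem hcard 0)
  generalize A.orderEmbOfFin hcard = x at *
  have hvec : (x : Fin 5 → ℤ) = ![x 0, x 1, x 2, x 3, x 4] := by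
    ext i; fin_cases i <;> rfl
  have hodd : ({1, 3, 5, 7, 9} : Finset ℤ).image (fun y => A.min' hne * y) =
      univ.image ![x 0, 3 * x 0, 5 * x 0, 7 * x 0, 9 * x 0] := by
    ext y
    simp [hmin, Fin.exists_fin_succ, mul_comm, eq_comm]
  rw [hodd]
  have h25 := ncard_signedSumset_odd_multiples h0
  rcases le_ncard_or_eq_odd_multiples h0 (hmono (by decide : (0 : Fin 5) < 1))
    (hmono (by decide : (1 : Fin 5) < 2)) (hmono (by decide : (2 : Fin 5) < 3))
    (hmono (by decide : (3 : Fin 5) < 4)) with h | ⟨h1, h2, h3, h4⟩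
  · rw [← hvec, hA] at h
    refine ⟨by omega, by omega, fun h' => ?_⟩
    rw [← h'] at h25
    omega
  · rw [h1, h2, h3, h4] at hvec
    rw [hvec] at hA
    rw [hA] at h25 ⊢
    exact ⟨h25.ge, fun _ => rfl, fun _ => h25⟩
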